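/- Let p : [t₀, ∞) × ℝ^n → ℝ^n be continuous and quasimonotone nondecreasing, and let r : [t₀, ∞) → ℝ^n be the maximal solution of v̇ = p(t, v), v(t₀) = v₀, in the sense that r solves this initial value problem on [t₀, ∞) and every solution v of the same initial value problem on a subinterval [t₀, T] satisfies v(t) ⪯ r(t) componentwise. Suppose m : [t₀, ∞) → ℝ^n is continuous and for every t ∈ [t₀, ∞) and every component index i, liminf_{h → 0⁻} (m_i(t+h) − m_i(t))/h ≤ p_i(t, m(t)). Then m(t₀) ⪯ v₀ implies m(t) ⪯ r(t) componentwise for all t ∈ [t₀, ∞). -/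

import Mathlib

lemma cmpA (N : ℝ → ℝ) (hmono : Monotone N)
    (hN : ∀ y, ∀ ε > 0, ∃ δ > 0, ∀ y', y - δ < y' → y' < y → N y - N y' ≤ ε * (y - y'))
    (α β : ℝ) (hαβ : α < β) : ∃ c d, α < c ∧ c < d ∧ d < β ∧ N c = N d := by
  set E : ℕ → Set ℝ := fun K => {y | ∀ y', y - 1 / ((K : ℝ) + 1) < y' → y' < y → N y - N y' ≤ y - y'} with hE
  have hclosed : ∀ K, IsClosed (E K) := by
    intro K
    refine isClosed_of_closure_subset ?_
    intro y hy y' h1 h2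
    by_contra hcon
    push Not at hcon
    obtain ⟨δ, hδ, hδ'⟩ := hN y 1 one_pos
    rw [Metric.mem_closure_iff] at hy
    obtain ⟨z, hz, hyz⟩ := hy (min (min δ (y - y')) (min (y' - (y - 1 / ((K : ℝ) + 1))) (N y - N y' - (y - y'))))
      (by refine lt_min (lt_min ?_ ?_) (lt_min ?_ ?_) <;> linarith)
    simp only [lt_min_iff, Real.dist_eq, abs_lt] at hyz
    obtain ⟨⟨⟨a1, a2⟩, b1, b2⟩, ⟨c1, c2⟩, d1, d2⟩ := hyz
    have h3 := hz y' (by linarith) (by linarith)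
    rcases le_or_gt y z with h | h
    · have := hmono h
      linarith
    · have := hδ' z (by linarith) h
      linarith
  have hcover : ⋃ K, E K = Set.univ := by
    rw [Set.eq_univ_iff_forall]
    intro y
    obtain ⟨δ, hδ, hδ'⟩ := hN y 1 one_pos
    obtain ⟨K, hK⟩ := exists_nat_one_div_lt hδ
    refine Set.mem_iUnion.2 ⟨K, fun y' h1 h2 => ?_⟩
    have := hδ' y' (by linarith) h2
    linarith
  have hd := dense_iUnion_interior_of_closed hclosed hcover
  obtain ⟨y, hy, hyK⟩ := hd.exists_mem_open isOpen_Ioo (Set.nonempty_Ioo.2 hαβ)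
  obtain ⟨K, hK⟩ := Set.mem_iUnion.1 hy
  obtain ⟨r, hr, hball⟩ := Metric.isOpen_iff.1 isOpen_interior y hK
  have hpos : (0 : ℝ) < 1 / ((K : ℝ) + 1) := by positivity
  obtain ⟨d, hyd, hd'⟩ : ∃ d, y < d ∧ d < min (min β (y + r)) (y + 1 / ((K : ℝ) + 1)) :=
    exists_between (lt_min (lt_min hyK.2 (by linarith)) (by linarith))
  simp only [lt_min_iff] at hd'
  obtain ⟨⟨hdβ, hdr⟩, hdK⟩ := hd'
  refine ⟨y, d, hyK.1, hyd, hdβ, ?_⟩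
  by_contra hne
  have hlt : N y < N d := lt_of_le_of_ne (hmono hyd.le) hne
  have hLip : ∀ u ∈ Set.Icc y d, ∀ w ∈ Set.Icc y d, u ≤ w → N w - N u ≤ w - u := by
    intro u hu w hw huw
    rcases huw.eq_or_lt with rfl | h
    · simp
    · refine interior_subset (hball (?_ : w ∈ Metric.ball y r)) u ?_ h
      · rw [Metric.mem_ball, Real.dist_eq, abs_lt]; constructor <;> linarith [hw.1, hw.2]
      · linarith [hu.1, hw.2]
  have hcont : ContinuousOn N (Set.Icc y d) := by
    have : LipschitzOnWith 1 N (Set.Icc y d) := by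
      refine LipschitzOnWith.of_dist_le_mul ?_
      intro u hu w hw
      rw [Real.dist_eq, Real.dist_eq, NNReal.coe_one, one_mul]
      rcases le_total u w with h | h
      · rw [abs_of_nonpos (by linarith [hmono h]), abs_of_nonpos (by linarith)]
        linarith [hLip u hu w hw h]
      · rw [abs_of_nonneg (by linarith [hmono h]), abs_of_nonneg (by linarith)]
        linarith [hLip w hw u hu h]
    exact this.continuousOn
  set c := (N d - N y) / (2 * (d - y)) with hc
  have hcpos : 0 < c := div_pos (by linarith) (by linarith)
  have hcm : c * (d - y) = (N d - N y) / 2 := by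
    rw [hc]; field_simp [show d - y ≠ 0 by linarith]
  obtain ⟨x, hx, hmax⟩ := isCompact_Icc.exists_isMaxOn (Set.nonempty_Icc.2 hyd.le)
    (hcont.sub (f := N) (g := fun t => c * t) (by fun_prop))
  have hxd : N d - c * d ≤ N x - c * x := hmax (Set.right_mem_Icc.2 hyd.le)
  have hyx : y < x := by
    rcases hx.1.eq_or_lt with h | h
    · rw [← h] at hxd; nlinarith
    · exact h
  obtain ⟨δ, hδ, hδ'⟩ := hN x (c / 2) (by linarith)
  obtain ⟨w, hw1, hw2⟩ := exists_between (max_lt hyx (show x - δ < x by linarith))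
  rw [max_lt_iff] at hw1
  have h1 := hδ' w hw1.2 hw2
  have h2 : N w - c * w ≤ N x - c * x := hmax ⟨hw1.1.le, by linarith [hx.2]⟩
  nlinarith

lemma cmpB (a b : ℝ) (hab : a < b) (G : ℝ → ℝ) (hG : ContinuousOn G (Set.Icc a b))
    (hlt : G a < G b)
    (hrec : ∀ x, a < x → x ≤ b → (∀ x', a ≤ x' → x' < x → G x' < G x) →
      ∀ C > 0, ∃ η > 0, ∀ x', x - η < x' → x' < x → C * (x - x') ≤ G x - G x') : False := by
  set S : ℝ → Set ℝ := fun y => {x | x ∈ Set.Icc a b ∧ min y (G b) ≤ G x} with hS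
  set N : ℝ → ℝ := fun y => sInf (S y) with hNdef
  have hbd : ∀ y, BddBelow (S y) := fun y => ⟨a, fun x hx => hx.1.1⟩
  have hne : ∀ y, (S y).Nonempty := fun y => ⟨b, ⟨hab.le, le_rfl⟩, min_le_right _ _⟩
  have hcl : ∀ y, IsClosed (S y) := by
    intro y
    have := hG.preimage_isClosed_of_isClosed isClosed_Icc (isClosed_Ici (a := min y (G b)))
    exact this
  have hmem : ∀ y, N y ∈ S y := fun y => (hcl y).csInf_mem (hne y) (hbd y)
  have hle : ∀ y x, x ∈ S y → N y ≤ x := fun y x hx => csInf_le (hbd y) hx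
  have hmono : Monotone N := by
    intro y y' h
    refine hle _ _ ⟨(hmem y').1, le_trans (min_le_min_right _ h) (hmem y').2⟩
  have hGN : ∀ y, G a < y → y ≤ G b → G (N y) = y := by
    intro y h1 h2
    have hm := hmem y
    have h3 : y ≤ G (N y) := by simpa [min_eq_left h2] using hm.2
    obtain ⟨z, hz, hzy⟩ := intermediate_value_Icc hm.1.1
      (hG.mono (Set.Icc_subset_Icc_right hm.1.2)) ⟨h1.le, h3⟩
    have : N y ≤ z := hle y z ⟨⟨hz.1, hz.2.trans hm.1.2⟩, by rw [hzy]; exact min_le_left _ _⟩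
    rw [le_antisymm this hz.2, hzy]
  suffices hN : ∀ y, ∀ ε > 0, ∃ δ > 0, ∀ y', y - δ < y' → y' < y → N y - N y' ≤ ε * (y - y') by
    obtain ⟨c, d, h1, h2, h3, h4⟩ := cmpA N hmono hN (G a) (G b) hlt
    have e1 := hGN c h1 (by linarith)
    have e2 := hGN d (by linarith) h3.le
    rw [h4] at e1; linarith
  intro y ε hε
  rcases le_or_gt y (G a) with hy | hy
  · refine ⟨1, one_pos, fun y' _ h => ?_⟩
    have ha : N y ≤ a := hle y a ⟨⟨le_rfl, hab.le⟩, (min_le_left _ _).trans hy⟩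
    have := (hmem y').1.1
    nlinarith
  rcases lt_or_ge (G b) y with hyb | hyb
  · refine ⟨y - G b, by linarith, fun y' h h' => ?_⟩
    have : N y = N y' := by
      simp only [hNdef, hS]
      rw [min_eq_right hyb.le, min_eq_right (by linarith)]
    rw [this]; nlinarith
  have hx := hmem y
  have hGx := hGN y hy hyb
  set x := N y with hxdef
  have hax : a < x := by
    rcases hx.1.1.eq_or_lt with h | h
    · rw [← h] at hGx; exact absurd hGx hy.ne
    · exact h
  have hbefore : ∀ x', a ≤ x' → x' < x → G x' < y := by
    intro x' h1 h2
    by_contra hcon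
    push Not at hcon
    have := hle y x' ⟨⟨h1, by linarith [hx.1.2]⟩, (min_le_left _ _).trans hcon⟩
    linarith
  obtain ⟨η, hη, hη'⟩ := hrec x hax hx.1.2 (by rw [hGx]; exact hbefore) (1 / ε) (by positivity)
  have hmx : a < max a (x - η) ∨ a = max a (x - η) := (le_max_left _ _).lt_or_eq
  have hmlt : max a (x - η) < x := max_lt hax (by linarith)
  obtain ⟨z, hz, hzmax⟩ := isCompact_Icc.exists_isMaxOn (Set.nonempty_Icc.2 (le_max_left a (x - η)))
    (hG.mono (Set.Icc_subset_Icc_right (by linarith [hx.1.2])))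
  have hzy := hbefore z hz.1 (by linarith [hz.2])
  refine ⟨y - G z, by linarith, fun y' h1 h2 => ?_⟩
  have hm' := hmem y'
  have hle' : N y' ≤ x := hmono h2.le
  have hGy' : y' ≤ G (N y') := by simpa [min_eq_left (h2.le.trans hyb)] using hm'.2
  rcases hle'.eq_or_lt with h | h
  · rw [h]; nlinarith
  have hgt : max a (x - η) < N y' := by
    by_contra hcon
    push Not at hcon
    have : G (N y') ≤ G z := hzmax ⟨hm'.1.1, hcon⟩
    linarith
  have h5 := hη' (N y') (lt_of_le_of_lt (le_max_right _ _) hgt) h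
  rw [hGx, one_div, inv_mul_le_iff₀ hε] at h5
  nlinarith

lemma cmpC (a b : ℝ) (hab : a ≤ b) (g : ℝ → ℝ) (hg : ContinuousOn g (Set.Icc a b))
    (H : ∀ x, a < x → x ≤ b →
      (∀ ε > 0, ∀ η > 0, ∃ x', x - η < x' ∧ x' < x ∧ g x - g x' < ε * (x - x')) ∨
      (∀ C > 0, ∃ η > 0, ∀ x', x - η < x' → x' < x → C * (x - x') ≤ g x - g x')) :
    g b ≤ g a := by
  by_contra hcon
  push Not at hcon
  have hab : a < b := hab.lt_of_ne (by rintro rfl; exact lt_irrefl _ hcon)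
  set l := (g b - g a) / (2 * (b - a)) with hl
  have hlpos : 0 < l := div_pos (by linarith) (by linarith)
  have hlm : l * (b - a) = (g b - g a) / 2 := by
    rw [hl]; field_simp [show b - a ≠ 0 by linarith]
  refine cmpB a b hab (fun t => g t - l * t) (hg.sub (by fun_prop)) (by nlinarith) ?_
  intro x hax hxb hrec C hC
  rcases H x hax hxb with h | h
  · obtain ⟨x', h1, h2, h3⟩ := h l hlpos (x - a) (by linarith)
    have := hrec x' (by linarith) h2
    linarith
  · obtain ⟨η, hη, h⟩ := h (C + l) (by linarith)
    refine ⟨η, hη, fun x' h1 h2 => ?_⟩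
    have := h x' h1 h2
    linarith

lemma cmpJunk (f : ℝ → ℝ) (t q : ℝ)
    (h : Filter.liminf (fun h : ℝ => (f (t + h) - f t) / h) (nhdsWithin 0 (Set.Iio 0)) ≤ q) :
      (∀ ε > 0, ∀ η > 0, ∃ x', t - η < x' ∧ x' < t ∧ f t - f x' < (q + ε) * (t - x')) ∨
      (∀ C, ∃ η > 0, ∀ x', t - η < x' → x' < t → C * (t - x') ≤ f t - f x') := by
  by_contra hcon
  push Not at hcon
  obtain ⟨⟨ε, hε, η, hη, h1⟩, C, h2⟩ := hcon
  rw [Filter.liminf_eq] at h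
  have hev : ∀ c, (∀ᶠ h in nhdsWithin (0:ℝ) (Set.Iio 0), c ≤ (f (t + h) - f t) / h) ↔
      ∃ η > 0, ∀ x', t - η < x' → x' < t → c * (t - x') ≤ f t - f x' := by
    intro c
    rw [eventually_nhdsWithin_iff, Metric.eventually_nhds_iff]
    refine exists_congr fun η => and_congr_right fun hη => ?_
    constructor
    · intro H x' h1 h2
      have := H (y := x' - t) (by rw [Real.dist_eq, abs_lt]; constructor <;> linarith) (by
        show x' - t < 0; linarith)
      rw [le_div_iff_of_neg (by linarith), show t + (x' - t) = x' by ring] at this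
      linarith
    · intro H y hy hy0
      have hy0 : y < 0 := hy0
      rw [Real.dist_eq, abs_lt] at hy
      have := H (t + y) (by linarith) (by linarith)
      rw [le_div_iff_of_neg hy0]
      linarith
  have hbdd : BddAbove {a | ∀ᶠ h in nhdsWithin (0:ℝ) (Set.Iio 0), a ≤ (f (t + h) - f t) / h} := by
    refine ⟨C, fun a ha => ?_⟩
    obtain ⟨η, hη, ha⟩ := (hev a).1 ha
    obtain ⟨x', h3, h4, h5⟩ := h2 η hη
    have := ha x' h3 h4
    by_contra hc
    nlinarith
  have := le_csSup hbdd ((hev (q + ε)).2 ⟨η, hη, h1⟩)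
  linarith

lemma cmpPeano {E : Type*} [NormedAddCommGroup E] [NormedSpace ℝ E] [CompleteSpace E] [ProperSpace E]
    (f : ℝ → E → E)
    (hf : Continuous (fun q : ℝ × E => f q.1 q.2)) (L : ℝ) (hL : ∀ t x, ‖f t x‖ ≤ L)
    (t₁ : ℝ) (v₁ : E) :
    ∃ v : ℝ → E, v t₁ = v₁ ∧ ∀ t ∈ Set.Icc t₁ (t₁ + 1),
      HasDerivWithinAt v (f t (v t)) (Set.Icc t₁ (t₁ + 1)) t := by
  have hL0 : 0 ≤ L := (norm_nonneg _).trans (hL 0 0)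
  -- delayed Picard iterates
  let d : ℕ → ℝ := fun k => 1 / ((k : ℝ) + 1)
  have hd : ∀ k, 0 < d k := fun k => by positivity
  let Φ : ℕ → (ℝ → E) → ℝ → E := fun k u t => v₁ + ∫ s in t₁..(max t t₁), f s (u (s - d k))
  let u : ℕ → ℕ → ℝ → E := fun k j => (Φ k)^[j] (fun _ => v₁)
  have hu0 : ∀ k, u k 0 = fun _ => v₁ := fun k => rfl
  have hus : ∀ k j, u k (j + 1) = Φ k (u k j) := fun k j => Function.iterate_succ_apply' _ _ _
  have hcontI : ∀ k (w : ℝ → E), Continuous w → Continuous (fun s => f s (w (s - d k))) := by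
    intro k w hw
    exact hf.comp (continuous_id.prodMk (hw.comp (continuous_id.sub continuous_const)))
  have hΦc : ∀ k w, Continuous w → Continuous (Φ k w) := by
    intro k w hw
    have h1 : Continuous (fun b => ∫ s in t₁..b, f s (w (s - d k))) :=
      intervalIntegral.continuous_primitive (fun a b => (hcontI k w hw).intervalIntegrable a b) t₁
    exact continuous_const.add (h1.comp (continuous_id.max continuous_const))
  have huc : ∀ k j, Continuous (u k j) := by
    intro k j
    induction j with
    | zero => rw [hu0]; exact continuous_const
    | succ j ih => rw [hus]; exact hΦc k _ ih
  have hstab : ∀ (k j : ℕ), ∀ t ≤ t₁ + (j : ℝ) * d k, u k (j + 1) t = u k j t := by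
    intro k j
    induction j with
    | zero =>
      intro t ht
      have : max t t₁ = t₁ := max_eq_right (by simpa using ht)
      rw [hus, hu0]
      simp [Φ, this]
    | succ j ih =>
      intro t ht
      rw [hus k (j + 1), hus k j]
      show v₁ + _ = v₁ + _
      rw [← hus k j]
      congr 1
      refine intervalIntegral.integral_congr fun s hs => ?_
      rw [Set.uIcc_of_le (le_max_right _ _)] at hs
      show f s _ = f s _
      rw [ih]
      push_cast at ht
      have h0 : 0 ≤ (j : ℝ) * d k := mul_nonneg (Nat.cast_nonneg _) (hd k).le
      rcases le_total t t₁ with h | h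
      · have := hs.2; rw [max_eq_right h] at this; linarith [hd k]
      · have := hs.2; rw [max_eq_left h] at this; linarith [hd k]
  let V : ℕ → ℝ → E := fun k => u k (k + 1)
  have hVc : ∀ k, Continuous (V k) := fun k => huc k _
  have hVfix : ∀ k, ∀ t ∈ Set.Icc t₁ (t₁ + 1), V k t = v₁ + ∫ s in t₁..t, f s (V k (s - d k)) := by
    intro k t ht
    have h1 : V k t = u k (k + 1 + 1) t := by
      refine (hstab k (k + 1) t ?_).symm
      have : ((k + 1 : ℕ) : ℝ) * d k = 1 := by
        simp only [d]; push_cast; field_simp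
      rw [this]; exact ht.2
    rw [h1, hus]
    show v₁ + _ = _
    rw [max_eq_left ht.1]
  have hVlip : ∀ k s t, ‖V k s - V k t‖ ≤ L * |s - t| := by
    intro k s t
    show ‖u k (k + 1) s - u k (k + 1) t‖ ≤ _
    rw [hus]
    show ‖(v₁ + _) - (v₁ + _)‖ ≤ _
    have hi := fun a b => (hcontI k (u k k) (huc k k)).intervalIntegrable (μ := MeasureTheory.volume) a b
    rw [add_sub_add_left_eq_sub, intervalIntegral.integral_interval_sub_left (hi _ _) (hi _ _)]
    refine (intervalIntegral.norm_integral_le_of_norm_le_const fun x _ => hL _ _).trans ?_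
    exact mul_le_mul_of_nonneg_left (abs_max_sub_max_le_abs _ _ _) hL0
  have hV1 : ∀ k, V k t₁ = v₁ := by
    intro k
    rw [hVfix k t₁ ⟨le_rfl, by linarith⟩]; simp
  let U : Ultrafilter ℕ := Filter.hyperfilter ℕ
  have hU : (U : Filter ℕ) ≤ Filter.atTop := by
    rw [← Nat.cofinite_eq_atTop]; exact Filter.hyperfilter_le_cofinite
  have hlim : ∀ t, ∃ x, Filter.Tendsto (fun k => V k t) U (nhds x) := by
    intro t
    obtain ⟨x, -, hx⟩ := (isCompact_closedBall v₁ (L * |t - t₁|)).ultrafilter_le_nhds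
      (U.map (fun k => V k t)) (by
        rw [Filter.le_principal_iff]
        refine Filter.mem_map.2 (Filter.univ_mem' fun k => ?_)
        show V k t ∈ Metric.closedBall v₁ (L * |t - t₁|)
        rw [mem_closedBall_iff_norm]
        have := hVlip k t t₁
        rwa [hV1] at this)
    exact ⟨x, hx⟩
  choose v hv using hlim
  refine ⟨v, ?_, ?_⟩
  · refine tendsto_nhds_unique (hv t₁) ?_
    simp only [hV1]; exact tendsto_const_nhds
  intro t ht
  rw [hasDerivWithinAt_iff_isLittleO, Asymptotics.isLittleO_iff]
  intro ε hε
  obtain ⟨ρ, hρ, hρ'⟩ := Metric.continuous_iff.1 hf (t, v t) ε hε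
  set σ := ρ / (3 * (L + 1)) with hσ
  have hσ0 : 0 < σ := by positivity
  have hσL : (L + 1) * σ = ρ / 3 := by rw [hσ]; field_simp
  filter_upwards [self_mem_nhdsWithin, mem_nhdsWithin_of_mem_nhds (Metric.ball_mem_nhds t hσ0)]
    with t' ht' htσ
  rw [Metric.mem_ball, Real.dist_eq] at htσ
  have hlim2 : Filter.Tendsto (fun k => ‖V k t' - V k t - (t' - t) • f t (v t)‖) U
      (nhds ‖v t' - v t - (t' - t) • f t (v t)‖) :=
    (((hv t').sub (hv t)).sub tendsto_const_nhds).norm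
  rw [Real.norm_eq_abs]
  refine le_of_tendsto hlim2 ?_
  have hdk : ∀ᶠ k in (U : Filter ℕ), d k < σ :=
    hU ((tendsto_one_div_add_atTop_nhds_zero_nat (𝕜 := ℝ)).eventually (gt_mem_nhds hσ0))
  have hvk : ∀ᶠ k in (U : Filter ℕ), dist (V k t) (v t) < ρ / 3 :=
    (hv t).eventually (Metric.ball_mem_nhds _ (by positivity))
  filter_upwards [hdk, hvk] with k h1 h2
  have hi := fun a b => (hcontI k (V k) (hVc k)).intervalIntegrable (μ := MeasureTheory.volume) a b
  have heq : V k t' - V k t - (t' - t) • f t (v t) =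
      ∫ s in t..t', (f s (V k (s - d k)) - f t (v t)) := by
    rw [intervalIntegral.integral_sub (hi _ _) intervalIntegrable_const,
      intervalIntegral.integral_const, hVfix k t' ht', hVfix k t ht, add_sub_add_left_eq_sub,
      intervalIntegral.integral_interval_sub_left (hi _ _) (hi _ _)]
  rw [heq]
  refine intervalIntegral.norm_integral_le_of_norm_le_const fun s hs => ?_
  have hst : |s - t| ≤ |t' - t| := by
    exact Set.abs_sub_left_of_mem_uIcc (Set.uIoc_subset_uIcc hs)
  rw [← dist_eq_norm]
  refine (hρ' (s, V k (s - d k)) ?_).le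
  rw [Prod.dist_eq, max_lt_iff]
  have hσρ : σ ≤ ρ / 3 := by nlinarith
  constructor
  · show dist s t < ρ
    rw [Real.dist_eq]; linarith
  · show dist (V k (s - d k)) (v t) < ρ
    have h3 : dist (V k (s - d k)) (V k t) ≤ L * (2 * σ) := by
      rw [dist_eq_norm]
      refine (hVlip _ _ _).trans (mul_le_mul_of_nonneg_left ?_ hL0)
      have := hd k
      rw [abs_le] at *
      constructor <;> linarith [hst.1, hst.2, neg_abs_le (t'-t)]
    have := dist_triangle (V k (s - d k)) (V k t) (v t)
    nlinarith

lemma cmpDeriv (u : ℝ → ℝ) (D x : ℝ) (h : HasDerivAt u D x) (ε : ℝ) (hε : 0 < ε) :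
    ∃ η > 0, ∀ x', x - η < x' → x' < x → |u x - u x' - D * (x - x')| ≤ ε * (x - x') := by
  rw [hasDerivAt_iff_isLittleO, Asymptotics.isLittleO_iff] at h
  obtain ⟨η, hη, h⟩ := Metric.eventually_nhds_iff.1 (h hε)
  refine ⟨η, hη, fun x' h1 h2 => ?_⟩
  have := h (y := x') (by rw [Real.dist_eq, abs_lt]; constructor <;> linarith)
  rw [Real.norm_eq_abs, Real.norm_eq_abs, abs_of_neg (a := x' - x) (by linarith), smul_eq_mul] at this
  rw [← abs_neg]
  convert this using 2 <;> ring

/-- Comparison along the left-lower Dini inequality with a differentiable function. -/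
lemma cmpDini (a b : ℝ) (hab : a ≤ b) (f u : ℝ → ℝ) (D q : ℝ → ℝ)
    (hf : ContinuousOn f (Set.Icc a b)) (hu : ContinuousOn u (Set.Icc a b))
    (hD : ∀ x, a < x → x ≤ b → HasDerivAt u (D x) x)
    (hq : ∀ x, a < x → x ≤ b → q x ≤ D x)
    (hd : ∀ x, a < x → x ≤ b →
      Filter.liminf (fun h : ℝ => (f (x + h) - f x) / h) (nhdsWithin 0 (Set.Iio 0)) ≤ q x) :
    f b - u b ≤ f a - u a := by
  refine cmpC a b hab (fun x => f x - u x) (hf.sub hu) ?_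
  intro x h1 h2
  have hqx := hq x h1 h2
  rcases cmpJunk f x (q x) (hd x h1 h2) with h | h
  · left
    intro ε hε η hη
    obtain ⟨η', hη', hu'⟩ := cmpDeriv u (D x) x (hD x h1 h2) (ε / 2) (by linarith)
    obtain ⟨x', h3, h4, h5⟩ := h (ε / 2) (by linarith) (min η η') (lt_min hη hη')
    have h6 := min_le_left η η'
    have h7 := min_le_right η η'
    refine ⟨x', by linarith, h4, ?_⟩
    have h8 := (abs_le.1 (hu' x' (by linarith) h4)).1
    nlinarith
  · right
    intro C hC
    obtain ⟨η', hη', hu'⟩ := cmpDeriv u (D x) x (hD x h1 h2) 1 one_pos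
    obtain ⟨η, hη, h⟩ := h (C + D x + 1)
    refine ⟨min η η', lt_min hη hη', fun x' h3 h4 => ?_⟩
    have h6 := min_le_left η η'
    have h7 := min_le_right η η'
    have h8 := (abs_le.1 (hu' x' (by linarith) h4)).2
    have h9 := h x' (by linarith) h4
    nlinarith

lemma cmpLocal {n : ℕ} (t₀ : ℝ)
    (p : ℝ → (Fin n → ℝ) → (Fin n → ℝ))
    (hp_cont : ContinuousOn (fun q : ℝ × (Fin n → ℝ) => p q.1 q.2)
      (Set.Ici t₀ ×ˢ Set.univ))
    (hquasi : ∀ t ∈ Set.Ici t₀, ∀ i : Fin n, ∀ x y : Fin n → ℝ,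
      x i = y i → (∀ j, j ≠ i → x j ≤ y j) → p t x i ≤ p t y i)
    (v₀ : Fin n → ℝ)
    (rmax : ℝ → Fin n → ℝ)
    (hr0 : rmax t₀ = v₀)
    (hrsol : ∀ t ∈ Set.Ici t₀, HasDerivAt rmax (p t (rmax t)) t)
    (hrmaximal : ∀ T, t₀ ≤ T → ∀ v : ℝ → Fin n → ℝ, v t₀ = v₀ →
      (∀ t ∈ Set.Icc t₀ T, HasDerivAt v (p t (v t)) t) →
      ∀ t ∈ Set.Icc t₀ T, ∀ i, v t i ≤ rmax t i)
    (m : ℝ → Fin n → ℝ) (hm_cont : ContinuousOn m (Set.Ici t₀))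
    (hdini : ∀ t ∈ Set.Ici t₀, ∀ i : Fin n,
      Filter.liminf (fun h : ℝ => (m (t + h) i - m t i) / h)
        (nhdsWithin 0 (Set.Iio 0)) ≤ p t (m t) i)
    (t₁ : ℝ) (ht₁ : t₀ ≤ t₁) (hm1 : m t₁ ≤ rmax t₁) :
    ∃ δ > 0, ∀ t, t₁ ≤ t → t ≤ t₁ + δ → m t ≤ rmax t := by
  -- truncated right-hand side
  let τ : ℝ → ℝ := fun t => max t₁ (min t (t₁ + 1))
  have hτc : Continuous τ := by fun_prop
  have hτ : ∀ t, τ t ∈ Set.Icc t₁ (t₁ + 1) := fun t =>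
    ⟨le_max_left _ _, max_le (by linarith) (min_le_right _ _)⟩
  have hτid : ∀ t ∈ Set.Icc t₁ (t₁ + 1), τ t = t := by
    intro t ht
    simp only [τ]; rw [min_eq_left ht.2, max_eq_right ht.1]
  let B : Fin n → ℝ := fun i => rmax t₁ i + 1
  let cl : ℝ → (Fin n → ℝ) → (Fin n → ℝ) := fun t x => m (τ t) ⊔ (x ⊓ B)
  let f : ℝ → (Fin n → ℝ) → (Fin n → ℝ) := fun t x => p (τ t) (cl t x)
  have hmτ : Continuous (fun t => m (τ t)) :=
    hm_cont.comp_continuous hτc fun t => ht₁.trans (hτ t).1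
  have hclc : Continuous (fun q : ℝ × (Fin n → ℝ) => cl q.1 q.2) :=
    continuous_pi fun i =>
      (((continuous_apply i).comp hmτ).comp continuous_fst).max
        (((continuous_apply i).comp continuous_snd).min continuous_const)
  have hf : Continuous (fun q : ℝ × (Fin n → ℝ) => f q.1 q.2) :=
    hp_cont.comp_continuous ((hτc.comp continuous_fst).prodMk hclc)
      fun q => ⟨ht₁.trans (hτ q.1).1, trivial⟩
  have hmc : ContinuousOn m (Set.Icc t₁ (t₁ + 1)) := hm_cont.mono fun t ht => ht₁.trans ht.1
  obtain ⟨M, hM⟩ := isCompact_Icc.exists_bound_of_continuousOn hmc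
  have hM' : ∀ t ∈ Set.Icc t₁ (t₁ + 1), ∀ i, |m t i| ≤ M := fun t ht i =>
    (norm_le_pi_norm (m t) i).trans (hM t ht)
  let lo : Fin n → ℝ := fun _ => -M
  let hi : Fin n → ℝ := fun _ => M
  have hbox : ∀ t x, cl t x ∈ Set.Icc lo (hi ⊔ B) := by
    intro t x
    have h1 : lo ≤ m (τ t) := fun i => (abs_le.1 (hM' _ (hτ t) i)).1
    have h2 : m (τ t) ≤ hi := fun i => (abs_le.1 (hM' _ (hτ t) i)).2
    exact ⟨h1.trans le_sup_left, sup_le_sup h2 inf_le_right⟩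
  obtain ⟨L, hL⟩ := ((isCompact_Icc (a := t₁) (b := t₁ + 1)).prod
    (isCompact_Icc (a := lo) (b := hi ⊔ B))).exists_bound_of_continuousOn
    (hp_cont.mono fun q hq => ⟨ht₁.trans hq.1.1, trivial⟩)
  obtain ⟨v, hv1, hv⟩ := cmpPeano f hf L (fun t x => hL (τ t, cl t x) ⟨hτ t, hbox t x⟩) t₁ (rmax t₁)
  have hvc : ContinuousOn v (Set.Icc t₁ (t₁ + 1)) := fun t ht => (hv t ht).continuousWithinAt
  have hvd : ∀ t, t₁ < t → t < t₁ + 1 → HasDerivAt v (f t (v t)) t := fun t h1 h2 =>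
    (hv t ⟨h1.le, h2.le⟩).hasDerivAt (Icc_mem_nhds h1 h2)
  -- v stays above m
  have hvm : ∀ t, t₁ ≤ t → t < t₁ + 1 → ∀ i, m t i ≤ v t i := by
    intro t h1 h2 i
    by_contra hcon
    push Not at hcon
    have hmi : ContinuousOn (fun s => m s i) (Set.Icc t₁ (t₁ + 1)) :=
      (continuous_apply i).comp_continuousOn hmc
    have hvi : ContinuousOn (fun s => v s i) (Set.Icc t₁ (t₁ + 1)) :=
      (continuous_apply i).comp_continuousOn hvc
    have hsub : Set.Icc t₁ t ⊆ Set.Icc t₁ (t₁ + 1) := Set.Icc_subset_Icc_right h2.le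
    have hcl : IsClosed {s | s ∈ Set.Icc t₁ t ∧ m s i - v s i ≤ 0} :=
      ((hmi.sub hvi).mono hsub).preimage_isClosed_of_isClosed isClosed_Icc isClosed_Iic
    have hne : {s | s ∈ Set.Icc t₁ t ∧ m s i - v s i ≤ 0}.Nonempty :=
      ⟨t₁, ⟨le_rfl, h1⟩, by rw [hv1]; linarith [hm1 i]⟩
    have hbd : BddAbove {s | s ∈ Set.Icc t₁ t ∧ m s i - v s i ≤ 0} := ⟨t, fun s hs => hs.1.2⟩
    have hs := hcl.csSup_mem hne hbd
    have hub := fun s hs => le_csSup hbd (a := s) hs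
    set s := sSup {s | s ∈ Set.Icc t₁ t ∧ m s i - v s i ≤ 0}
    have hss : Set.Icc s t ⊆ Set.Icc t₁ (t₁ + 1) := Set.Icc_subset_Icc hs.1.1 h2.le
    have := cmpDini s t hs.1.2 (fun x => m x i) (fun x => v x i) (fun x => f x (v x) i)
      (fun x => p x (m x) i) (hmi.mono hss) (hvi.mono hss)
      (fun x hx1 hx2 => hasDerivAt_pi.1 (hvd x (by linarith [hs.1.1]) (by linarith)) i)
      (fun x hx1 hx2 => by
        have hxI : x ∈ Set.Icc t₁ (t₁ + 1) := ⟨by linarith [hs.1.1], by linarith⟩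
        have hlt : v x i < m x i := by
          by_contra hc
          have := hub x ⟨⟨hxI.1, hx2⟩, by linarith⟩
          linarith
        show p x (m x) i ≤ p (τ x) (cl x (v x)) i
        simp only [cl]
        rw [hτid x hxI]
        refine hquasi x (ht₁.trans hxI.1) i _ _ ?_ fun j _ => ?_
        · show m x i = m x i ⊔ (v x i ⊓ B i)
          exact (sup_eq_left.2 (inf_le_left.trans hlt.le)).symm
        · exact (le_sup_left : m x j ≤ m x j ⊔ (v x j ⊓ B j)))
      (fun x hx1 hx2 => hdini x (by show t₀ ≤ x; linarith [hs.1.1]) i)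
    linarith [hs.2]
  -- v stays below B for a short time
  obtain ⟨δ, hδ, hδ1, hδB⟩ : ∃ δ > 0, δ < 1 ∧ ∀ t, t₁ ≤ t → t ≤ t₁ + δ → v t ≤ B := by
    have hev : ∀ᶠ t in nhdsWithin t₁ (Set.Icc t₁ (t₁ + 1)), ∀ i, v t i < B i := by
      rw [Filter.eventually_all]
      intro i
      have h1 : Filter.Tendsto (fun t => v t i) (nhdsWithin t₁ (Set.Icc t₁ (t₁ + 1))) (nhds (v t₁ i)) :=
        ((continuous_apply i).comp_continuousOn hvc) t₁ ⟨le_rfl, by linarith⟩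
      refine h1.eventually (gt_mem_nhds ?_)
      rw [hv1]; show rmax t₁ i < rmax t₁ i + 1; linarith
    rw [eventually_nhdsWithin_iff, Metric.eventually_nhds_iff] at hev
    obtain ⟨η, hη, hev⟩ := hev
    have h1 := min_le_left η 1
    have h2 := min_le_right η 1
    have h3 : 0 < min η 1 := lt_min hη one_pos
    refine ⟨min η 1 / 2, by linarith, by linarith, fun t ht1 ht2 i => ?_⟩
    refine (hev (y := t) ?_ ⟨ht1, by linarith⟩ i).le
    rw [Real.dist_eq, abs_lt]; constructor <;> linarith
  have hfv : ∀ t, t₁ ≤ t → t ≤ t₁ + δ → f t (v t) = p t (v t) := by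
    intro t h1 h2
    simp only [f, cl]
    rw [hτid t ⟨h1, by linarith⟩, inf_eq_left.2 (hδB t h1 h2),
      sup_eq_right.2 (fun i => hvm t h1 (by linarith) i)]
  -- glue
  let w : ℝ → Fin n → ℝ := fun t => if t ≤ t₁ then rmax t else v t
  have hwl : ∀ t, t ≤ t₁ → w t = rmax t := fun t h => if_pos h
  have hwr : ∀ t, t₁ ≤ t → w t = v t := by
    intro t h
    rcases h.eq_or_lt with rfl | h
    · rw [hwl _ le_rfl, hv1]
    · exact if_neg (not_le.2 h)
  refine ⟨δ, hδ, fun t h1 h2 i => ?_⟩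
  refine (hvm t h1 (by linarith) i).trans ?_
  rw [← hwr t h1]
  refine hrmaximal (t₁ + δ) (by linarith) w (by rw [hwl _ ht₁, hr0]) ?_ t ⟨by linarith, h2⟩ i
  intro s hs
  rcases lt_trichotomy s t₁ with h | h | h
  · rw [hwl s h.le]
    refine (hrsol s hs.1).congr_of_eventuallyEq ?_
    filter_upwards [Iio_mem_nhds h] with x hx
    exact hwl x (le_of_lt hx)
  · subst h
    have hl : HasDerivWithinAt w (p s (w s)) (Set.Iic s) s := by
      rw [hwl s le_rfl]
      exact (hrsol s hs.1).hasDerivWithinAt.congr (fun x hx => hwl x hx) (hwl s le_rfl)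
    have hr : HasDerivWithinAt w (p s (w s)) (Set.Ici s) s := by
      have h3 := hv s ⟨le_rfl, by linarith⟩
      rw [hfv s le_rfl (by linarith)] at h3
      rw [hwr s le_rfl]
      have h4 : HasDerivWithinAt w (p s (v s)) (Set.Icc s (s + 1)) s :=
        h3.congr (fun x hx => hwr x hx.1) (hwr s le_rfl)
      exact h4.mono_of_mem_nhdsWithin (Icc_mem_nhdsGE (by linarith))
    have := hl.union hr
    rwa [Set.Iic_union_Ici, hasDerivWithinAt_univ] at this
  · rw [hwr s h.le, ← hfv s h.le hs.2]
    refine (hvd s h (by linarith [hs.2])).congr_of_eventuallyEq ?_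
    filter_upwards [Ioi_mem_nhds h] with x hx
    exact hwr x (le_of_lt hx)


/-- generalized vectorial comparison lemma (Lemma 1 /
Theorem 1.5.4 of Lakshmikantham–Leela, modified). -/
theorem generalized_comparison_lemma {n : ℕ} (t₀ : ℝ)
    (p : ℝ → (Fin n → ℝ) → (Fin n → ℝ))
    -- p is continuous on [t₀,∞) × ℝⁿ
    (hp_cont : ContinuousOn (fun q : ℝ × (Fin n → ℝ) => p q.1 q.2)
      (Set.Ici t₀ ×ˢ Set.univ))
    -- p is quasimonotone nondecreasing
    (hquasi : ∀ t ∈ Set.Ici t₀, ∀ i : Fin n, ∀ x y : Fin n → ℝ,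
      x i = y i → (∀ j, j ≠ i → x j ≤ y j) → p t x i ≤ p t y i)
    (v₀ : Fin n → ℝ)
    -- rmax is the maximal solution of v̇ = p(t,v), v(t₀) = v₀ on [t₀,∞)
    (rmax : ℝ → Fin n → ℝ)
    (hr0 : rmax t₀ = v₀)
    (hrsol : ∀ t ∈ Set.Ici t₀, HasDerivAt rmax (p t (rmax t)) t)
    (hrmaximal : ∀ T, t₀ ≤ T → ∀ v : ℝ → Fin n → ℝ, v t₀ = v₀ →
      (∀ t ∈ Set.Icc t₀ T, HasDerivAt v (p t (v t)) t) →
      ∀ t ∈ Set.Icc t₀ T, ∀ i, v t i ≤ rmax t i)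
    -- m is continuous and satisfies the Dini-derivative differential inequality
    (m : ℝ → Fin n → ℝ) (hm_cont : ContinuousOn m (Set.Ici t₀))
    (hdini : ∀ t ∈ Set.Ici t₀, ∀ i : Fin n,
      Filter.liminf (fun h : ℝ => (m (t + h) i - m t i) / h)
        (nhdsWithin 0 (Set.Iio 0)) ≤ p t (m t) i)
    -- m(t₀) ⪯ v₀
    (hm0 : ∀ i, m t₀ i ≤ v₀ i) :
    ∀ t ∈ Set.Ici t₀, ∀ i, m t i ≤ rmax t i := by
  intro T hT
  have hrc : ContinuousOn rmax (Set.Icc t₀ T) := fun t ht =>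
    (hrsol t ht.1).continuousAt.continuousWithinAt
  have hmc : ContinuousOn m (Set.Icc t₀ T) := hm_cont.mono fun t ht => ht.1
  have hcl : IsClosed ({t | m t ≤ rmax t} ∩ Set.Icc t₀ T) := by
    rw [Set.inter_comm]
    exact isClosed_Icc.isClosed_le hmc hrc
  have hsub := hcl.Icc_subset_of_forall_exists_gt (fun i => by rw [hr0]; exact hm0 i) (by
    intro x hx y hy
    obtain ⟨δ, hδ, h⟩ := cmpLocal t₀ p hp_cont hquasi v₀ rmax hr0 hrsol hrmaximal m hm_cont hdini
      x hx.2.1 hx.1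
    have hy : x < y := hy
    refine ⟨min y (x + δ), h _ (le_min hy.le (by linarith)) (min_le_right _ _),
      lt_min hy (by linarith), min_le_left _ _⟩)
  exact fun i => hsub ⟨hT, le_rfl⟩ i
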